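/- Let P be a prime of A = F_q[θ] of degree d, R = k_s[θ]/(P), and α ∈ k_s[θ]. If w ∈ R((t^{−1}))/R[t] satisfies ατ(w) ≡ (t − θ)^n w (mod R[t]), then applying the relation d times and using τ^d = id on R yields (P(t)^n − ρ_α(P))·w ≡ 0 (mod R[t]), where ρ_α(P) ∈ k_s is the element congruent to α·τ(α)···τ^{d−1}(α) modulo P, and P(t) is P with θ replaced by t. -/

import Mathlib

/-- The action of a polynomial `p ∈ R[t]` on the quotient `R((t⁻¹))/R[t]`, identified
with the space of tails `w : ℕ → R` (where `w i` is the coefficient of `t^{-(i+1)}`):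
`(p · w) i = ∑_j p_j · w (i + j)` (multiply and discard the polynomial part). -/
noncomputable def polyAct {R : Type*} [CommRing R] (p : Polynomial R) (w : ℕ → R) :
    ℕ → R :=
  fun i => ∑ j ∈ Finset.range (p.natDegree + 1), p.coeff j * w (i + j)

open Polynomial in
theorem aux_prod_L {F : Type*} [Field F] [Fintype F] (P : F[X]) (hP : Irreducible P)
    (hPm : P.Monic) :
    P.map (algebraMap F (AdjoinRoot P)) =
      ∏ i ∈ Finset.range P.natDegree,
        (X - C ((AdjoinRoot.root P) ^ (Fintype.card F ^ i))) := by
  have : Fact (Irreducible P) := ⟨hP⟩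
  have : Module.Finite F (AdjoinRoot P) := hPm.finite_adjoinRoot
  have : Finite (AdjoinRoot P) := Module.finite_of_finite F
  have hfr : Module.finrank F (AdjoinRoot P) = P.natDegree := by
    rw [(AdjoinRoot.powerBasis hP.ne_zero).finrank, AdjoinRoot.powerBasis_dim]
  have hpow : ∀ i (x : AdjoinRoot P),
      (FiniteField.frobeniusAlgHom F (AdjoinRoot P) ^ i) x = x ^ (Fintype.card F ^ i) := by
    intro i x
    induction i with
    | zero => simp
    | succ k ih =>
      rw [pow_succ', AlgHom.mul_apply, ih, FiniteField.coe_frobeniusAlgHom]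
      simp only
      rw [← pow_mul, pow_succ]
  have hroot : aeval (AdjoinRoot.root P) P = 0 := by
    rw [AdjoinRoot.aeval_eq, AdjoinRoot.mk_self]
  have hinj : Set.InjOn (fun i => (AdjoinRoot.root P) ^ (Fintype.card F ^ i))
      (Finset.range P.natDegree : Set ℕ) := by
    intro i hi j hj hij
    simp only [Finset.coe_range, Set.mem_Iio] at hi hj
    have h := (FiniteField.bijective_frobeniusAlgHom_pow F (AdjoinRoot P)).1
      (a₁ := ⟨i, hfr ▸ hi⟩) (a₂ := ⟨j, hfr ▸ hj⟩) (by
        apply AdjoinRoot.algHom_ext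
        simpa only [hpow] using hij)
    simpa using h
  have hmon : (∏ i ∈ Finset.range P.natDegree,
      (X - C ((AdjoinRoot.root P) ^ (Fintype.card F ^ i)))).Monic :=
    monic_prod_of_monic _ _ fun i _ => monic_X_sub_C _
  refine (eq_of_monic_of_dvd_of_natDegree_le hmon (hPm.map _) ?_ ?_)
  · apply Finset.prod_dvd_of_coprime
    · intro i hi j hj hij
      exact isCoprime_X_sub_C_of_isUnit_sub
        ((sub_ne_zero.2 fun h => hij (hinj hi hj h)).isUnit)
    · intro i _
      rw [dvd_iff_isRoot, IsRoot, eval_map_algebraMap, ← hpow, aeval_algHom_apply, hroot, map_zero]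
  · rw [natDegree_map, natDegree_prod_of_monic _ _ fun i _ => monic_X_sub_C _]
    simp only [natDegree_X_sub_C, Finset.sum_const, Finset.card_range, smul_eq_mul, mul_one, le_refl]

open Polynomial in
theorem aux_prod {F : Type*} [Field F] [Fintype F] (P : F[X]) (hP : Irreducible P)
    (hPm : P.Monic) {R : Type*} [CommRing R] [Algebra F R] (θ : R) (hθ : aeval θ P = 0) :
    P.map (algebraMap F R) =
      ∏ i ∈ Finset.range P.natDegree, (X - C (θ ^ (Fintype.card F ^ i))) := by
  have heval : P.eval₂ (algebraMap F R) θ = 0 := hθ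
  have h := congrArg (Polynomial.map
    (AdjoinRoot.lift (algebraMap F R) θ heval)) (aux_prod_L P hP hPm)
  rw [Polynomial.map_map, Polynomial.map_prod] at h
  have e : (AdjoinRoot.lift (algebraMap F R) θ heval).comp
      (algebraMap F (AdjoinRoot P)) = algebraMap F R := by
    ext x; exact AdjoinRoot.lift_of heval
  rw [e] at h
  rw [h]
  refine Finset.prod_congr rfl fun i _ => ?_
  rw [Polynomial.map_sub, Polynomial.map_X, Polynomial.map_C, map_pow, AdjoinRoot.lift_root heval]

/-- The shift operator (multiplication by `t`). -/
def auxShift (R : Type*) [CommRing R] : Module.End R (ℕ → R) where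
  toFun w := fun i => w (i + 1)
  map_add' _ _ := rfl
  map_smul' _ _ := rfl

theorem auxShift_pow {R : Type*} [CommRing R] (j : ℕ) (w : ℕ → R) (i : ℕ) :
    (auxShift R ^ j) w i = w (i + j) := by
  induction j generalizing i with
  | zero => rfl
  | succ k ih =>
    rw [pow_succ', Module.End.mul_apply]
    change (auxShift R ^ k) w (i + 1) = _
    rw [ih]; congr 1; ring

theorem polyAct_eq {R : Type*} [CommRing R] (p : Polynomial R) (w : ℕ → R) :
    polyAct p w = Polynomial.aeval (auxShift R) p w := by
  funext i
  rw [Polynomial.aeval_eq_sum_range, LinearMap.sum_apply, Finset.sum_apply]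
  simp [polyAct, auxShift_pow]

theorem aux_map {R : Type*} [CommRing R] (τ : R →+* R) (p : Polynomial R) (w : ℕ → R) :
    (fun i => τ (Polynomial.aeval (auxShift R) p w i)) =
      Polynomial.aeval (auxShift R) (p.map τ) (fun i => τ (w i)) := by
  funext i
  rw [Polynomial.aeval_eq_sum_range,
    Polynomial.aeval_eq_sum_range' (n := p.natDegree + 1)
      (Nat.lt_succ_of_le Polynomial.natDegree_map_le),
    LinearMap.sum_apply, Finset.sum_apply, LinearMap.sum_apply, Finset.sum_apply]
  simp [auxShift_pow]

open Polynomial in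
theorem aux_iter {R : Type*} [CommRing R] (τ : R →+* R) (a : R) (p : R[X]) (w : ℕ → R)
    (hw : (fun i => a * τ (w i)) = aeval (auxShift R) p w) (m : ℕ) :
    (fun i => (∏ k ∈ Finset.range m, (⇑τ)^[k] a) * (⇑τ)^[m] (w i)) =
      aeval (auxShift R) (∏ k ∈ Finset.range m, (Polynomial.map τ)^[k] p) w := by
  induction m with
  | zero => simp
  | succ m ih =>
    have h1 := aux_map τ (∏ k ∈ Finset.range m, (Polynomial.map τ)^[k] p) w
    rw [← ih] at h1
    have h2 := congrArg (fun v => a • v) h1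
    simp only at h2
    rw [← map_smul] at h2
    have h3 : (a • fun i => τ (w i)) = aeval (auxShift R) p w := hw
    rw [h3, ← Module.End.mul_apply, ← map_mul, Polynomial.map_prod] at h2
    rw [Finset.prod_range_succ' _ m, Finset.prod_range_succ' _ m]
    simp only [Function.iterate_succ_apply', Function.iterate_zero, id]
    rw [← h2]
    funext i
    simp only [Pi.smul_apply, smul_eq_mul, map_mul, map_prod]
    ring

/-- Let `P` be a prime of `A = 𝔽_q[θ]` of degree `d`, `k_s` a field (e.g.
`𝔽_q(t₁,…,t_s)`), `R = k_s[θ]/(P)`, with `τ : R → R` the `k_s`-linear Frobenius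
(`τ(θ) = θ^q`, `τ^d = id`), and `α ∈ k_s[θ]`.  If `w ∈ R((t⁻¹))/R[t]` satisfies
`α·τ(w) ≡ (t - θ)^n · w (mod R[t])`, then `(P(t)^n - ρ_α(P)) · w ≡ 0 (mod R[t])`,
where `ρ_α(P) ∈ k_s` is the element congruent to `α·τ(α)⋯τ^{d-1}(α)` modulo `P` and
`P(t)` is `P` with `θ` replaced by `t`. -/
theorem stmt18 {F : Type*} [Field F] [Fintype F] {Ks : Type*} [Field Ks] [Algebra F Ks]
    (P : Polynomial F) (hP : Irreducible P) (hPmonic : P.Monic)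
    {d : ℕ} (hd : P.natDegree = d) (hd0 : 0 < d)
    (τ : (Polynomial Ks ⧸ Ideal.span {P.map (algebraMap F Ks)}) →+*
         (Polynomial Ks ⧸ Ideal.span {P.map (algebraMap F Ks)}))
    (hτKs : ∀ c : Ks,
      τ (algebraMap Ks (Polynomial Ks ⧸ Ideal.span {P.map (algebraMap F Ks)}) c) =
        algebraMap Ks _ c)
    (hτθ : τ (Ideal.Quotient.mk (Ideal.span {P.map (algebraMap F Ks)}) Polynomial.X) =
      Ideal.Quotient.mk _ Polynomial.X ^ Fintype.card F)
    (hτd : ∀ r, (⇑τ)^[d] r = r)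
    (α : Polynomial Ks) (ρ : Ks)
    (hρ : algebraMap Ks (Polynomial Ks ⧸ Ideal.span {P.map (algebraMap F Ks)}) ρ =
      ∏ i ∈ Finset.range d, (⇑τ)^[i] (Ideal.Quotient.mk _ α))
    (n : ℕ) (w : ℕ → (Polynomial Ks ⧸ Ideal.span {P.map (algebraMap F Ks)}))
    (hw : (fun i => Ideal.Quotient.mk (Ideal.span {P.map (algebraMap F Ks)}) α * τ (w i)) =
      polyAct ((Polynomial.X -
        Polynomial.C (Ideal.Quotient.mk (Ideal.span {P.map (algebraMap F Ks)})
          Polynomial.X)) ^ n) w) :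
    polyAct ((P.map (algebraMap F
        (Polynomial Ks ⧸ Ideal.span {P.map (algebraMap F Ks)}))) ^ n -
      Polynomial.C (algebraMap Ks _ ρ)) w = 0 := by
  have hθ : Polynomial.aeval (Ideal.Quotient.mk (Ideal.span {P.map (algebraMap F Ks)})
      Polynomial.X) P = 0 := by
    have h1 := Polynomial.aeval_map_algebraMap Ks
      (Ideal.Quotient.mk (Ideal.span {P.map (algebraMap F Ks)}) Polynomial.X) P
    rw [← h1]
    have h2 : Polynomial.aeval (Ideal.Quotient.mk (Ideal.span {P.map (algebraMap F Ks)})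
      Polynomial.X) (P.map (algebraMap F Ks)) =
        Ideal.Quotient.mkₐ Ks (Ideal.span {P.map (algebraMap F Ks)})
          (Polynomial.aeval Polynomial.X (P.map (algebraMap F Ks))) := by
      rw [← Polynomial.aeval_algHom_apply]; rfl
    rw [h2, Polynomial.aeval_X_left_apply, Ideal.Quotient.mkₐ_eq_mk,
      Ideal.Quotient.eq_zero_iff_mem]
    exact Ideal.mem_span_singleton_self _
  rw [polyAct_eq] at hw
  have h := aux_iter τ _ _ w hw d
  rw [← hρ] at h
  simp only [hτd] at h
  have hk : ∀ k, (Polynomial.map τ)^[k] ((Polynomial.X -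
        Polynomial.C (Ideal.Quotient.mk (Ideal.span {P.map (algebraMap F Ks)})
          Polynomial.X)) ^ n) = (Polynomial.X -
        Polynomial.C (Ideal.Quotient.mk (Ideal.span {P.map (algebraMap F Ks)})
          Polynomial.X ^ (Fintype.card F ^ k))) ^ n := by
    intro k
    induction k with
    | zero => simp
    | succ k ih =>
      rw [Function.iterate_succ_apply', ih, Polynomial.map_pow, Polynomial.map_sub,
        Polynomial.map_X, Polynomial.map_C, map_pow, hτθ, ← pow_mul, pow_succ']
  simp only [hk] at h
  rw [Finset.prod_pow, ← hd, ← aux_prod P hP hPmonic _ hθ] at h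
  rw [polyAct_eq, map_sub, LinearMap.sub_apply, ← h, Polynomial.aeval_C]
  funext i
  rw [Module.algebraMap_end_apply]
  exact sub_self _
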